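/- arXiv:2106.13564 — 6 statements merged into one kernel-verified Lean document; each statement's English description precedes it below -/
import Mathlib

section
/- In the counterfactual model, assume P(X = 1, Y = 1) > 0 and P(X = 0, Y = 0) > 0. Then the probabilities of causation satisfy the exact decomposition PNS = P(X = 1, Y = 1) · PN + P(X = 0, Y = 0) · PS. -/
open MeasureTheory ProbabilityTheory

/-- Pearl's Lemma 1: in the counterfactual model with binary cause `X`, potential
responses `Y0, Y1` and observed outcome `Y = Y_X` (consistency), if
`P(X = 1, Y = 1) > 0` and `P(X = 0, Y = 0) > 0`, then
`PNS = P(X = 1, Y = 1) · PN + P(X = 0, Y = 0) · PS`. -/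
theorem pns_decomposition
    {Ω : Type*} [MeasurableSpace Ω] (P : Measure Ω) [IsProbabilityMeasure P]
    (X Y0 Y1 Y : Ω → Bool)
    (hX : Measurable X) (hY0 : Measurable Y0) (hY1 : Measurable Y1)
    (hcons : ∀ ω, Y ω = if X ω = true then Y1 ω else Y0 ω)
    (h11 : 0 < P {ω | X ω = true ∧ Y ω = true})
    (h00 : 0 < P {ω | X ω = false ∧ Y ω = false}) :
    (P {ω | Y1 ω = true ∧ Y0 ω = false}).toReal =
      (P {ω | X ω = true ∧ Y ω = true}).toReal *
        (P[{ω | Y0 ω = false} | {ω | X ω = true ∧ Y ω = true}]).toReal +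
      (P {ω | X ω = false ∧ Y ω = false}).toReal *
        (P[{ω | Y1 ω = true} | {ω | X ω = false ∧ Y ω = false}]).toReal := by
  have hY : Measurable Y := by
    rw [funext hcons]
    exact Measurable.ite (hX (measurableSet_singleton true)) hY1 hY0
  have hXt : MeasurableSet {ω | X ω = true} := hX (measurableSet_singleton true)
  have h_cause : MeasurableSet {ω | X ω = true ∧ Y ω = true} :=
    hXt.inter (hY (measurableSet_singleton true))
  have h_no_cause : MeasurableSet {ω | X ω = false ∧ Y ω = false} :=
    (hX (measurableSet_singleton false)).inter (hY (measurableSet_singleton false))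
  have necessary : {ω | X ω = true ∧ Y ω = true} ∩ {ω | Y0 ω = false} =
      {ω | Y1 ω = true ∧ Y0 ω = false} ∩ {ω | X ω = true} := by
    ext ω
    have := hcons ω
    simp only [Set.mem_inter_iff, Set.mem_ofPred_eq]
    grind
  have sufficient : {ω | X ω = false ∧ Y ω = false} ∩ {ω | Y1 ω = true} =
      {ω | Y1 ω = true ∧ Y0 ω = false} \ {ω | X ω = true} := by
    ext ω
    have := hcons ω
    simp only [Set.mem_inter_iff, Set.mem_sdiff, Set.mem_ofPred_eq]
    grind
  rw [← ENNReal.toReal_mul, ← ENNReal.toReal_mul, mul_comm (P _), mul_comm (P _),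
    cond_mul_eq_inter h_cause, cond_mul_eq_inter h_no_cause,
    necessary, sufficient,
    ← ENNReal.toReal_add (measure_ne_top P _) (measure_ne_top P _),
    measure_inter_add_sdiff _ hXt]
end

section
/- In the counterfactual model, assume X is exogenous relative to Y, Y is monotonic relative to X, and 0 < P(X = 1) < 1. Then PNS is identifiable from the observational distribution and equals the difference of the factual and counterfactual probabilities: PNS = p_f − p_cf. -/
open MeasureTheory ProbabilityTheory

theorem ProbabilityTheory.IndepFun.cond_preimage_eq {Ω α β : Type*} [MeasurableSpace Ω]
    [MeasurableSpace α] [MeasurableSpace β] {P : Measure Ω} [IsFiniteMeasure P]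
    {f : Ω → α} {g : Ω → β} (h : IndepFun f g P) (hg : Measurable g)
    {s : Set α} {t : Set β} (hs : MeasurableSet s) (ht : MeasurableSet t)
    (hpos : P (g ⁻¹' t) ≠ 0) :
    P[f ⁻¹' s | g ⁻¹' t] = P (f ⁻¹' s) := by
  rw [cond_apply (hg ht), Set.inter_comm, h.measure_inter_preimage_eq_mul s t hs ht,
    mul_comm (P (f ⁻¹' s)), ← mul_assoc, ENNReal.inv_mul_cancel hpos (measure_ne_top P _), one_mul]

/-- In the counterfactual model with binary cause `X`, potential responses `Y0, Y1`
and observed outcome `Y = Y_X` (consistency), if `X` is exogenous relative to `Y`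
(i.e. `(Y0, Y1)` is independent of `X`), `Y` is monotonic relative to `X`
(i.e. `P(Y1 = 0, Y0 = 1) = 0`) and `0 < P(X = 1) < 1`, then the probability of
necessary and sufficient causation is identifiable from the observational
distribution: `PNS = p_f − p_cf` where `p_f = P(Y = 1 | X = 1)` and
`p_cf = P(Y = 1 | X = 0)`. -/
theorem pns_identifiable
    {Ω : Type*} [MeasurableSpace Ω] (P : Measure Ω) [IsProbabilityMeasure P]
    (X Y0 Y1 Y : Ω → Bool)
    (hX : Measurable X) (hY0 : Measurable Y0) (hY1 : Measurable Y1)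
    (hcons : ∀ ω, Y ω = if X ω = true then Y1 ω else Y0 ω)
    (hexo : IndepFun (fun ω => (Y0 ω, Y1 ω)) X P)
    (hmono : P {ω | Y1 ω = false ∧ Y0 ω = true} = 0)
    (hX0 : 0 < P {ω | X ω = true}) (hX1 : P {ω | X ω = true} < 1) :
    (P {ω | Y1 ω = true ∧ Y0 ω = false}).toReal =
      (P[{ω | Y ω = true} | {ω | X ω = true}]).toReal -
        (P[{ω | Y ω = true} | {ω | X ω = false}]).toReal := by
  have hXfalse : P {ω | X ω = false} ≠ 0 := by
    intro h0
    have hcompl : {ω | X ω = true}ᶜ = {ω | X ω = false} := by ext ω; simp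
    have hsum := prob_add_prob_compl (μ := P) (hX (measurableSet_singleton true))
    change P {ω | X ω = true} + P {ω | X ω = true}ᶜ = 1 at hsum
    rw [hcompl, h0, add_zero] at hsum
    exact hX1.ne hsum
  have hfact : P[{ω | Y ω = true} | {ω | X ω = true}] = P {ω | Y1 ω = true} := by
    have hXm : MeasurableSet {ω | X ω = true} := hX (measurableSet_singleton true)
    have hint : {ω | X ω = true} ∩ {ω | Y ω = true} =
        {ω | X ω = true} ∩ {ω | Y1 ω = true} := by
      ext ω
      simp +contextual [hcons]
    rw [← cond_inter_self hXm, hint, cond_inter_self hXm]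
    have hindep : IndepFun Y1 X P := hexo.comp measurable_snd measurable_id
    exact hindep.cond_preimage_eq (s := {true}) (t := {true}) hX
      (measurableSet_singleton true) (measurableSet_singleton true) hX0.ne'
  have hcf : P[{ω | Y ω = true} | {ω | X ω = false}] = P {ω | Y0 ω = true} := by
    have hXm : MeasurableSet {ω | X ω = false} := hX (measurableSet_singleton false)
    have hint : {ω | X ω = false} ∩ {ω | Y ω = true} =
        {ω | X ω = false} ∩ {ω | Y0 ω = true} := by
      ext ω
      simp +contextual [hcons]
    rw [← cond_inter_self hXm, hint, cond_inter_self hXm]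
    have hindep : IndepFun Y0 X P := hexo.comp measurable_fst measurable_id
    exact hindep.cond_preimage_eq (s := {true}) (t := {false}) hX
      (measurableSet_singleton true) (measurableSet_singleton false) hXfalse
  have hY0m : MeasurableSet {ω | Y0 ω = true} := hY0 (measurableSet_singleton true)
  have hY1m : MeasurableSet {ω | Y1 ω = true} := hY1 (measurableSet_singleton true)
  have hpns : {ω | Y1 ω = true ∧ Y0 ω = false} = {ω | Y1 ω = true} \ {ω | Y0 ω = true} := by
    ext ω; simp
  have hdef : {ω | Y1 ω = false ∧ Y0 ω = true} = {ω | Y0 ω = true} \ {ω | Y1 ω = true} := by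
    ext ω; simp [and_comm]
  rw [hdef] at hmono
  rw [hfact, hcf, hpns, ← measure_inter_add_sdiff {ω | Y0 ω = true} hY1m, hmono, add_zero,
    ← measure_inter_add_sdiff {ω | Y1 ω = true} hY0m,
    ENNReal.toReal_add (measure_ne_top P _) (measure_ne_top P _),
    Set.inter_comm {ω | Y0 ω = true}]
  ring
end

section
/- In the counterfactual model, assume X is exogenous relative to Y, Y is monotonic relative to X, 0 < P(X = 1) < 1 and P(X = 1, Y = 1) > 0. Then the probability of necessary causation is identifiable and equals PN = (p_f − p_cf) / p_f = 1 − p_cf/p_f. -/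
open MeasureTheory ProbabilityTheory

/-- Events determined by independent random variables multiply, in real-valued form. -/
theorem measureReal_inter_of_indepFun {Ω α β : Type*} [MeasurableSpace Ω] [MeasurableSpace α]
    [MeasurableSpace β] {P : Measure Ω} {f : Ω → α} {g : Ω → β} (h : IndepFun f g P)
    {s : Set α} {t : Set β} (hs : MeasurableSet s) (ht : MeasurableSet t) :
    P.real (g ⁻¹' t ∩ f ⁻¹' s) = P.real (g ⁻¹' t) * P.real (f ⁻¹' s) := by
  rw [Set.inter_comm, measureReal_def, h.measure_inter_preimage_eq_mul _ _ hs ht,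
    ENNReal.toReal_mul, mul_comm]
  rfl

/-- The real-valued form of `ProbabilityTheory.cond_apply`. -/
theorem measureReal_cond_apply {Ω : Type*} [MeasurableSpace Ω] {P : Measure Ω} {s : Set Ω}
    (hs : MeasurableSet s) (t : Set Ω) :
    P[|s].real t = (P.real s)⁻¹ * P.real (s ∩ t) := by
  rw [measureReal_def, cond_apply hs, ENNReal.toReal_mul, ENNReal.toReal_inv]
  rfl

/-- In the counterfactual model with binary cause `X`, potential responses `Y0, Y1`
and observed outcome `Y = Y_X` (consistency), if `X` is exogenous relative to `Y`,
`Y` is monotonic relative to `X`, `0 < P(X = 1) < 1` and `P(X = 1, Y = 1) > 0`,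
then the probability of necessary causation `PN = P(Y0 = 0 | X = 1, Y = 1)` is
identifiable and equals `(p_f − p_cf)/p_f = 1 − p_cf/p_f`, where
`p_f = P(Y = 1 | X = 1)` and `p_cf = P(Y = 1 | X = 0)`. -/
theorem pn_identifiable
    {Ω : Type*} [MeasurableSpace Ω] (P : Measure Ω) [IsProbabilityMeasure P]
    (X Y0 Y1 Y : Ω → Bool)
    (hX : Measurable X) (hY0 : Measurable Y0) (hY1 : Measurable Y1)
    (hcons : ∀ ω, Y ω = if X ω = true then Y1 ω else Y0 ω)
    (hexo : IndepFun (fun ω => (Y0 ω, Y1 ω)) X P)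
    (hmono : P {ω | Y1 ω = false ∧ Y0 ω = true} = 0)
    (hX0 : 0 < P {ω | X ω = true}) (hX1 : P {ω | X ω = true} < 1)
    (h11 : 0 < P {ω | X ω = true ∧ Y ω = true})
    (pf pcf pn : ℝ)
    (hpf : pf = (P[{ω | Y ω = true} | {ω | X ω = true}]).toReal)
    (hpcf : pcf = (P[{ω | Y ω = true} | {ω | X ω = false}]).toReal)
    (hpn : pn = (P[{ω | Y0 ω = false} | {ω | X ω = true ∧ Y ω = true}]).toReal) :
    pn = (pf - pcf) / pf ∧ pn = 1 - pcf / pf := by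
  have hXm (x : Bool) : MeasurableSet {ω | X ω = x} := hX (MeasurableSet.singleton x)
  have hY0m (y : Bool) : MeasurableSet {ω | Y0 ω = y} := hY0 (MeasurableSet.singleton y)
  have hY1m (y : Bool) : MeasurableSet {ω | Y1 ω = y} := hY1 (MeasurableSet.singleton y)
  have indep (x : Bool) (s : Set (Bool × Bool)) :
      P.real ({ω | X ω = x} ∩ {ω | (Y0 ω, Y1 ω) ∈ s}) =
        P.real {ω | X ω = x} * P.real {ω | (Y0 ω, Y1 ω) ∈ s} :=
    measureReal_inter_of_indepFun hexo s.toFinite.measurableSet (MeasurableSet.singleton x)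
  have factual : {ω | X ω = true} ∩ {ω | Y ω = true} = {ω | X ω = true} ∩ {ω | Y1 ω = true} := by
    ext ω; simp +contextual [hcons]
  have counterfactual :
      {ω | X ω = false} ∩ {ω | Y ω = true} = {ω | X ω = false} ∩ {ω | Y0 ω = true} := by
    ext ω; simp +contextual [hcons]
  have treated_pos : 0 < P.real {ω | X ω = true} :=
    ENNReal.toReal_pos hX0.ne' (measure_ne_top _ _)
  have untreated_pos : 0 < P.real {ω | X ω = false} := by
    have hcompl : {ω | X ω = false} = {ω | X ω = true}ᶜ := by ext ω; simp
    rw [hcompl, probReal_compl_eq_one_sub (hXm true), sub_pos, measureReal_def]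
    exact ENNReal.toReal_lt_of_lt_ofReal (by simpa using hX1)
  have factual_mul := indep true {p | p.2 = true}
  have counterfactual_mul := indep false {p | p.1 = true}
  have benefit_mul := indep true {p | p.2 = true ∧ p.1 = false}
  simp only [Set.mem_ofPred_eq] at factual_mul counterfactual_mul benefit_mul
  rw [Set.ofPred_and] at benefit_mul
  have response_pos : 0 < P.real {ω | Y1 ω = true} := by
    have hpos : 0 < P.real ({ω | X ω = true} ∩ {ω | Y ω = true}) :=
      ENNReal.toReal_pos h11.ne' (measure_ne_top _ _)
    rw [factual, factual_mul] at hpos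
    exact pos_of_mul_pos_right hpos treated_pos.le
  have benefit : P.real ({ω | Y1 ω = true} ∩ {ω | Y0 ω = false}) =
      P.real {ω | Y1 ω = true} - P.real {ω | Y0 ω = true} := by
    have h1 := measureReal_inter_add_sdiff (μ := P) (s := {ω | Y1 ω = true}) (hY0m false)
    have h2 := measureReal_inter_add_sdiff (μ := P) (s := {ω | Y0 ω = true}) (hY1m false)
    have hzero : P.real ({ω | Y0 ω = true} ∩ {ω | Y1 ω = false}) = 0 := by
      rw [Set.inter_comm, measureReal_def]
      exact (congrArg ENNReal.toReal hmono).trans ENNReal.toReal_zero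
    have hdiff : {ω | Y1 ω = true} \ {ω | Y0 ω = false} =
        {ω | Y0 ω = true} \ {ω | Y1 ω = false} := by
      ext ω; simp [and_comm]
    rw [hdiff] at h1
    linarith
  have pf_eq : pf = P.real {ω | Y1 ω = true} := by
    rw [hpf, ← measureReal_def, measureReal_cond_apply (hXm true), factual, factual_mul,
      inv_mul_cancel_left₀ treated_pos.ne']
  have pcf_eq : pcf = P.real {ω | Y0 ω = true} := by
    rw [hpcf, ← measureReal_def, measureReal_cond_apply (hXm false), counterfactual,
      counterfactual_mul, inv_mul_cancel_left₀ untreated_pos.ne']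
  have pn_eq : pn = (pf - pcf) / pf := by
    rw [hpn, ← measureReal_def, Set.ofPred_and, factual,
      measureReal_cond_apply ((hXm true).inter (hY1m true)), Set.inter_assoc,
      benefit_mul, factual_mul, benefit, ← pf_eq, ← pcf_eq, inv_mul_eq_div,
      mul_div_mul_left _ _ treated_pos.ne']
  have pf_ne : pf ≠ 0 := pf_eq ▸ response_pos.ne'
  exact ⟨pn_eq, by rw [pn_eq, sub_div, div_self pf_ne]⟩
end

section
/- In the counterfactual model, assume X is exogenous relative to Y, Y is monotonic relative to X, and 0 < P(X = 1) < 1. Then the factual probability dominates the counterfactual probability: p_f ≥ p_cf. (Thus p_f ≥ p_cf is a necessary condition for the monotonicity assumption.) -/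
open MeasureTheory ProbabilityTheory

/-- If `Z` is independent of `X` and the outcome `Y` agrees with `Z` on `{X = x}`, then
conditioning `{Y = y}` on `{X = x}` gives the unconditional probability of `{Z = y}`. -/
theorem cond_eq_of_indepFun_of_eqOn {Ω α β : Type*} [MeasurableSpace Ω]
    [MeasurableSpace α] [MeasurableSingletonClass α]
    [MeasurableSpace β] [MeasurableSingletonClass β]
    {P : Measure Ω} [IsFiniteMeasure P] {X : Ω → α} {Y Z : Ω → β} {x : α} (y : β)
    (hX : Measurable X) (hZX : IndepFun Z X P) (hYZ : ∀ ω, X ω = x → Y ω = Z ω)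
    (hx : P {ω | X ω = x} ≠ 0) :
    P[{ω | Y ω = y} | {ω | X ω = x}] = P {ω | Z ω = y} := by
  have hset : {ω | X ω = x} ∩ {ω | Y ω = y} = Z ⁻¹' {y} ∩ X ⁻¹' {x} := by
    ext ω
    simp only [Set.mem_inter_iff, Set.mem_ofPred_eq, Set.mem_preimage, Set.mem_singleton_iff]
    constructor
    · rintro ⟨h, h'⟩
      exact ⟨(hYZ ω h).symm.trans h', h⟩
    · rintro ⟨h', h⟩
      exact ⟨h, (hYZ ω h).trans h'⟩
  rw [cond_apply (s := {ω | X ω = x}) (hX (measurableSet_singleton x)), hset,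
    hZX.measure_inter_preimage_eq_mul _ _ (measurableSet_singleton y)
      (measurableSet_singleton x), mul_comm (P (Z ⁻¹' {y})), ← mul_assoc]
  change (P {ω | X ω = x})⁻¹ * P {ω | X ω = x} * P {ω | Z ω = y} = _
  rw [ENNReal.inv_mul_cancel hx (measure_ne_top P _), one_mul]

/-- In the counterfactual model with binary cause `X`, potential responses `Y0, Y1`
and observed outcome `Y = Y_X` (consistency), if `X` is exogenous relative to `Y`,
`Y` is monotonic relative to `X` and `0 < P(X = 1) < 1`, then the factual
probability dominates the counterfactual probability:
`p_f = P(Y = 1 | X = 1) ≥ P(Y = 1 | X = 0) = p_cf`. -/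
theorem factual_dominates_counterfactual
    {Ω : Type*} [MeasurableSpace Ω] (P : Measure Ω) [IsProbabilityMeasure P]
    (X Y0 Y1 Y : Ω → Bool)
    (hX : Measurable X) (hY0 : Measurable Y0) (hY1 : Measurable Y1)
    (hcons : ∀ ω, Y ω = if X ω = true then Y1 ω else Y0 ω)
    (hexo : IndepFun (fun ω => (Y0 ω, Y1 ω)) X P)
    (hmono : P {ω | Y1 ω = false ∧ Y0 ω = true} = 0)
    (hX0 : 0 < P {ω | X ω = true}) (hX1 : P {ω | X ω = true} < 1) :
    (P[{ω | Y ω = true} | {ω | X ω = false}]).toReal ≤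
      (P[{ω | Y ω = true} | {ω | X ω = true}]).toReal := by
  have hfalse : P {ω | X ω = false} ≠ 0 := by
    intro h
    have hcompl : {ω | X ω = true}ᶜ = {ω | X ω = false} := by
      ext ω
      simp
    exact hX1.ne ((prob_compl_eq_zero_iff (hX (measurableSet_singleton true))).1 (hcompl ▸ h))
  rw [cond_eq_of_indepFun_of_eqOn (Z := Y0) true hX
      (hexo.comp measurable_fst measurable_id) (fun ω h => by simp [hcons, h]) hfalse,
    cond_eq_of_indepFun_of_eqOn (Z := Y1) true hX
      (hexo.comp measurable_snd measurable_id) (fun ω h => by simp [hcons, h]) hX0.ne']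
  refine ENNReal.toReal_mono (measure_ne_top P _) (measure_mono_ae ?_)
  filter_upwards [measure_eq_zero_iff_ae_notMem.1 hmono] with ω hω h0
  by_contra h1
  exact hω ⟨Bool.eq_false_iff.2 h1, h0⟩
end

section
/- Let (Ω, 𝓕, P) be a probability space and C, E measurable events with 0 < P(C) < 1; set p_f := P(E | C) and p_cf := P(E | Cᶜ), and assume p_f > 0, p_cf < 1 and p_f ≥ p_cf. Then the conditional-probability formulas for the probabilities of causation satisfy the decomposition P(C ∩ E) · (1 − p_cf/p_f)₊ + P(Cᶜ ∩ Eᶜ) · (1 − (1 − p_f)/(1 − p_cf))₊ = (p_f − p_cf)₊, i.e. P(C ∩ E)·PN + P(Cᶜ ∩ Eᶜ)·PS = PNS. -/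
open MeasureTheory ProbabilityTheory

/-- The multiplication rule `P(C ∩ E) = P(C) · P(E | C)`, with real values. -/
theorem toReal_inter_eq_mul_cond {Ω : Type*} [MeasurableSpace Ω] (P : Measure Ω)
    [IsFiniteMeasure P] {C : Set Ω} (hC : MeasurableSet C) (E : Set Ω) :
    (P (C ∩ E)).toReal = (P C).toReal * (P[E | C]).toReal := by
  rw [← cond_mul_eq_inter hC E P, ENNReal.toReal_mul, mul_comm]

/-- For a cause event `C` and impact event `E` on a probability space with
`0 < P(C) < 1`, `p_f := P(E | C) > 0`, `p_cf := P(E | Cᶜ) < 1` and `p_f ≥ p_cf`,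
the conditional-probability formulas for the probabilities of causation satisfy
`P(C ∩ E) · PN + P(Cᶜ ∩ Eᶜ) · PS = PNS`, where `PN = (1 − p_cf/p_f)₊`,
`PS = (1 − (1 − p_f)/(1 − p_cf))₊` and `PNS = (p_f − p_cf)₊`. -/
theorem pc_decomposition
    {Ω : Type*} [MeasurableSpace Ω] (P : Measure Ω) [IsProbabilityMeasure P]
    (C E : Set Ω) (hC : MeasurableSet C) (hE : MeasurableSet E)
    (hC0 : 0 < P C) (hC1 : P C < 1)
    (pf pcf : ℝ)
    (hpf : pf = (P[E | C]).toReal) (hpcf : pcf = (P[E | Cᶜ]).toReal)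
    (hpf0 : 0 < pf) (hpcf1 : pcf < 1) (hord : pcf ≤ pf) :
    (P (C ∩ E)).toReal * max (1 - pcf / pf) 0 +
      (P (Cᶜ ∩ Eᶜ)).toReal * max (1 - (1 - pf) / (1 - pcf)) 0 =
      max (pf - pcf) 0 := by
  have hfactual := toReal_inter_eq_mul_cond P hC E
  have hcounter := toReal_inter_eq_mul_cond P hC.compl E
  have hsplit : (P (Cᶜ ∩ E)).toReal + (P (Cᶜ ∩ Eᶜ)).toReal = (P Cᶜ).toReal := by
    simpa [Measure.real, Set.sdiff_eq] using measureReal_inter_add_sdiff (μ := P) (s := Cᶜ) hE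
  have hcompl : (P C).toReal + (P Cᶜ).toReal = 1 :=
    probReal_add_probReal_compl hC
  rw [← hpf] at hfactual
  rw [← hpcf] at hcounter
  have hnoncause : (P (Cᶜ ∩ Eᶜ)).toReal = (P Cᶜ).toReal * (1 - pcf) := by
    linear_combination hsplit - hcounter
  have hpf_ne : pf ≠ 0 := hpf0.ne'
  have hpcf_ne : 1 - pcf ≠ 0 := (sub_pos.2 hpcf1).ne'
  have hPN : 0 ≤ 1 - pcf / pf := sub_nonneg.2 (div_le_one_of_le₀ hord hpf0.le)
  have hPS : 0 ≤ 1 - (1 - pf) / (1 - pcf) :=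
    sub_nonneg.2 (div_le_one_of_le₀ (by linarith) (by linarith))
  rw [max_eq_left hPN, max_eq_left hPS, max_eq_left (sub_nonneg.2 hord), hfactual, hnoncause]
  field_simp
  linear_combination (pf - pcf) * hcompl
end

section
/- Let N be a norm on ℝ^d, δ ∈ (0, 1], and C : [0,1]^d → [0,1] a function lying in a δ-neighbourhood of the generalised Pareto copula associated with N, in the sense that there exist constants K > 0 and ε > 0 with |1 − C(u) − N(𝟙 − u)| ≤ K · N(𝟙 − u) · ‖𝟙 − u‖^δ for all u ∈ [0,1]^d with ‖𝟙 − u‖ ≤ ε (‖·‖ the Euclidean norm). Then for every u ∈ (0,1]^d the rescaled powers converge to the upper extreme value limit at the polynomial rate n^{−δ}: there exist M > 0 and n₀ such that |C(u^{1/n})ⁿ − exp(−N(−log u))| ≤ M n^{−δ} for all n ≥ n₀, where u^{1/n} and log u are taken componentwise; in particular C(u^{1/n})ⁿ → exp(−N(−log u)) as n → ∞. -/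
open Filter

/-- A seminorm on `ℝ^d` is dominated by a multiple of the `ℓ¹` norm. -/
lemma Seminorm.le_sum_mul_sum_abs {ι : Type*} [Fintype ι] [DecidableEq ι]
    (p : Seminorm ℝ (ι → ℝ)) (w : ι → ℝ) :
    p w ≤ (∑ i, p (Pi.single i 1)) * ∑ i, |w i| := by
  have hw : w = ∑ i, w i • (Pi.single i 1 : ι → ℝ) := by
    ext j
    simp [Finset.sum_apply, Pi.single_apply]
  calc p w = p (∑ i, w i • (Pi.single i 1 : ι → ℝ)) := by rw [← hw]
    _ ≤ ∑ i, p (w i • (Pi.single i 1 : ι → ℝ)) :=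
        Finset.le_sum_of_subadditive p (map_zero p).le (map_add_le_add p) _ _
    _ = ∑ i, p (Pi.single i 1) * |w i| := by
        simp [map_smul_eq_mul, mul_comm]
    _ ≤ ∑ i, p (Pi.single i 1) * ∑ j, |w j| := by
        gcongr with i
        exact Finset.single_le_sum (f := fun j => |w j|) (fun j _ => abs_nonneg _)
          (Finset.mem_univ i)
    _ = _ := by rw [Finset.sum_mul]

lemma abs_pow_sub_pow_le_mul_of_mem_Icc {a b : ℝ} (ha : a ∈ Set.Icc (0 : ℝ) 1)
    (hb : b ∈ Set.Icc (0 : ℝ) 1) (n : ℕ) : |a ^ n - b ^ n| ≤ n * |a - b| := by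
  have hmax : max |a| |b| ≤ 1 :=
    max_le (abs_le.2 ⟨by linarith [ha.1], ha.2⟩) (abs_le.2 ⟨by linarith [hb.1], hb.2⟩)
  calc |a ^ n - b ^ n| ≤ |a - b| * n * max |a| |b| ^ (n - 1) := abs_pow_sub_pow_le ..
    _ ≤ |a - b| * n * 1 := by
        gcongr
        exact pow_le_one₀ (le_max_of_le_left (abs_nonneg a)) hmax
    _ = n * |a - b| := by ring

lemma Real.sqrt_sum_sq_le_sum_abs {ι : Type*} (s : Finset ι) (f : ι → ℝ) :
    Real.sqrt (∑ i ∈ s, f i ^ 2) ≤ ∑ i ∈ s, |f i| := by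
  refine Real.sqrt_le_iff.2 ⟨Finset.sum_nonneg fun i _ => abs_nonneg _, ?_⟩
  simpa only [sq_abs] using
    Finset.sum_sq_le_sq_sum_of_nonneg (s := s) (f := fun i => |f i|) fun i _ => abs_nonneg _

/-- If a copula-like function `C` on `[0,1]^d` lies in a `δ`-neighbourhood of the
generalised Pareto copula `u ↦ 1 − N(𝟙 − u)` associated with a norm `N` on `ℝ^d`
(in the sense that `|1 − C(u) − N(𝟙 − u)| ≤ K · N(𝟙 − u) · ‖𝟙 − u‖^δ` for `u`
close to `𝟙`, with `‖·‖` the Euclidean norm), then for every `u ∈ (0,1]^d` the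
rescaled powers `C(u^{1/n})ⁿ` converge to the upper extreme value limit
`exp(−N(−log u))` at the polynomial rate `n^{−δ}`. -/
theorem gpc_delta_neighbourhood_polynomial_rate
    {d : ℕ} (hd : 0 < d) (N : (Fin d → ℝ) → ℝ)
    (hN0 : ∀ v, N v = 0 ↔ v = 0)
    (hNhom : ∀ (c : ℝ) (v : Fin d → ℝ), N (c • v) = |c| * N v)
    (hNtri : ∀ v w : Fin d → ℝ, N (v + w) ≤ N v + N w)
    (δ : ℝ) (hδ : δ ∈ Set.Ioc (0 : ℝ) 1)
    (C : (Fin d → ℝ) → ℝ)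
    (hCrange : ∀ u : Fin d → ℝ, (∀ i, u i ∈ Set.Icc (0 : ℝ) 1) →
      C u ∈ Set.Icc (0 : ℝ) 1)
    (K ε : ℝ) (hK : 0 < K) (hε : 0 < ε)
    (hnb : ∀ u : Fin d → ℝ, (∀ i, u i ∈ Set.Icc (0 : ℝ) 1) →
      Real.sqrt (∑ i, (1 - u i) ^ 2) ≤ ε →
      |1 - C u - N (fun i => 1 - u i)| ≤
        K * N (fun i => 1 - u i) * Real.sqrt (∑ i, (1 - u i) ^ 2) ^ δ) :
    ∀ u : Fin d → ℝ, (∀ i, u i ∈ Set.Ioc (0 : ℝ) 1) →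
      (∃ M > (0 : ℝ), ∃ n₀ : ℕ, ∀ n ≥ n₀,
        |C (fun i => u i ^ ((n : ℝ))⁻¹) ^ n -
            Real.exp (-N (fun i => -Real.log (u i)))| ≤ M * (n : ℝ) ^ (-δ)) ∧
      Tendsto (fun n : ℕ => C (fun i => u i ^ ((n : ℝ))⁻¹) ^ n) atTop
        (nhds (Real.exp (-N (fun i => -Real.log (u i))))) := by
  intro u hu
  suffices hrate : ∃ M > (0 : ℝ), ∃ n₀ : ℕ, ∀ n ≥ n₀,
      |C (fun i => u i ^ ((n : ℝ))⁻¹) ^ n -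
        Real.exp (-N (fun i => -Real.log (u i)))| ≤ M * (n : ℝ) ^ (-δ) by
    refine ⟨hrate, ?_⟩
    obtain ⟨M, -, n₀, h⟩ := hrate
    rw [tendsto_iff_dist_tendsto_zero]
    have hlim : Tendsto (fun n : ℕ => M * (n : ℝ) ^ (-δ)) atTop (nhds 0) := by
      simpa using ((tendsto_rpow_neg_atTop hδ.1).comp
        tendsto_natCast_atTop_atTop).const_mul M
    refine squeeze_zero' (Eventually.of_forall fun n => dist_nonneg) ?_ hlim
    filter_upwards [eventually_ge_atTop n₀] with n hn
    simpa only [Real.dist_eq] using h n hn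
  let p : Seminorm ℝ (Fin d → ℝ) := Seminorm.of N hNtri (by simpa using hNhom)
  have hNp : ∀ v, N v = p v := fun v => rfl
  simp only [hNp] at hnb ⊢
  set x : Fin d → ℝ := fun i => -Real.log (u i) with hx
  have hx0 : ∀ i, 0 ≤ x i := fun i => neg_nonneg.2 (Real.log_nonpos (hu i).1.le (hu i).2)
  set A : ℝ := ∑ i, p (Pi.single i 1)
  have hA : 0 ≤ A := Finset.sum_nonneg fun i _ => apply_nonneg p _
  set S : ℝ := ∑ i, x i
  have hS : 0 ≤ S := Finset.sum_nonneg fun i _ => hx0 i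
  have hxS : ∀ i, x i ≤ S := fun i =>
    Finset.single_le_sum (fun j _ => hx0 j) (Finset.mem_univ i)
  set B : ℝ := ∑ i, x i ^ 2
  have hB : 0 ≤ B := Finset.sum_nonneg fun i _ => sq_nonneg _
  have hpx : 0 ≤ p x := apply_nonneg p _
  refine ⟨K * (A * S) * S ^ δ + A * B + p x ^ 2 + 1, by positivity, ?_⟩
  obtain ⟨n₀, hn₀⟩ := exists_nat_ge (1 + S + S / ε + p x)
  refine ⟨n₀, fun n hn => ?_⟩
  have hn' : 1 + S + S / ε + p x ≤ (n : ℝ) := hn₀.trans (by exact_mod_cast hn)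
  have hSε : 0 ≤ S / ε := by positivity
  have hn1 : (1 : ℝ) ≤ n := by linarith
  have hnpos : (0 : ℝ) < n := by linarith
  set w : Fin d → ℝ := fun i => u i ^ ((n : ℝ))⁻¹
  have hw : ∀ i, w i = Real.exp (-(x i / n)) := fun i => by
    simp only [w, hx, Real.rpow_def_of_pos (hu i).1]
    congr 1
    ring
  have hw01 : ∀ i, w i ∈ Set.Icc (0 : ℝ) 1 := fun i => by
    rw [hw]
    exact ⟨(Real.exp_pos _).le,
      Real.exp_le_one_iff.2 (neg_nonpos.2 (div_nonneg (hx0 i) hnpos.le))⟩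
  set v : Fin d → ℝ := fun i => 1 - w i
  have hv_le : ∀ i, |v i| ≤ x i / n := fun i => by
    rw [abs_of_nonneg (sub_nonneg.2 (hw01 i).2)]
    have := Real.add_one_le_exp (-(x i / n))
    simp only [hw]
    linarith
  have hv_sub : ∀ i, |(v - (n : ℝ)⁻¹ • x) i| ≤ x i ^ 2 / (n : ℝ) ^ 2 := fun i => by
    have hle : |-(x i / n)| ≤ 1 := by
      rw [abs_neg, abs_of_nonneg (div_nonneg (hx0 i) hnpos.le), div_le_one hnpos]
      linarith [hxS i]
    have h := Real.abs_exp_sub_one_sub_id_le hle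
    rw [← abs_neg] at h
    convert h using 1
    · simp only [v, hw, Pi.sub_apply, Pi.smul_apply, smul_eq_mul]
      congr 1
      ring
    · ring
  have hv_sum : ∑ i, |v i| ≤ S / n := by
    rw [Finset.sum_div]
    exact Finset.sum_le_sum fun i _ => hv_le i
  have hnorm : Real.sqrt (∑ i, v i ^ 2) ≤ S / n :=
    (Real.sqrt_sum_sq_le_sum_abs _ _).trans hv_sum
  have hpv : p v ≤ A * S / n := by
    rw [mul_div_assoc]
    exact (p.le_sum_mul_sum_abs v).trans (by gcongr)
  have hnear : Real.sqrt (∑ i, v i ^ 2) ≤ ε := by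
    refine hnorm.trans ((div_le_comm₀ hnpos hε).2 ?_)
    linarith
  have hrpow : (n : ℝ) ^ (-δ) / n = 1 / ((n : ℝ) ^ δ * n) := by
    rw [Real.rpow_neg hnpos.le]
    field_simp
  have hC : |1 - C w - p v| ≤ K * (A * S) * S ^ δ * ((n : ℝ) ^ (-δ) / n) := by
    calc |1 - C w - p v| ≤ K * p v * Real.sqrt (∑ i, v i ^ 2) ^ δ := hnb w hw01 hnear
      _ ≤ K * (A * S / n) * (S / n) ^ δ := by
        have := hδ.1.le
        gcongr
      _ = _ := by
        rw [Real.div_rpow hS hnpos.le, hrpow]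
        field_simp
  have hsq : 1 / (n : ℝ) ^ 2 ≤ (n : ℝ) ^ (-δ) / n := by
    have : (n : ℝ) ^ δ ≤ n := by
      simpa using Real.rpow_le_rpow_of_exponent_le hn1 hδ.2
    rw [hrpow, sq]
    gcongr
  have hpsub : |p v - p x / n| ≤ A * B * ((n : ℝ) ^ (-δ) / n) := by
    have hscale : p x / n = p ((n : ℝ)⁻¹ • x) := by
      rw [map_smul_eq_mul, Real.norm_of_nonneg (by positivity), div_eq_inv_mul]
    calc |p v - p x / n| ≤ p (v - (n : ℝ)⁻¹ • x) := by
          rw [hscale]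
          exact abs_sub_map_le_sub p _ _
      _ ≤ A * ∑ i, |(v - (n : ℝ)⁻¹ • x) i| := p.le_sum_mul_sum_abs _
      _ ≤ A * (B / (n : ℝ) ^ 2) := by
          rw [Finset.sum_div]
          gcongr with i
          exact hv_sub i
      _ = A * B * (1 / (n : ℝ) ^ 2) := by ring
      _ ≤ _ := by gcongr
  have hexp : |Real.exp (-(p x / n)) - 1 - -(p x / n)| ≤
      p x ^ 2 * ((n : ℝ) ^ (-δ) / n) := by
    have hle : |-(p x / n)| ≤ 1 := by
      rw [abs_neg, abs_of_nonneg (div_nonneg hpx hnpos.le), div_le_one hnpos]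
      linarith
    calc _ ≤ (-(p x / n)) ^ 2 := Real.abs_exp_sub_one_sub_id_le hle
      _ = p x ^ 2 * (1 / (n : ℝ) ^ 2) := by ring
      _ ≤ _ := by gcongr
  have hdiff : |C w - Real.exp (-(p x / n))| ≤
      (K * (A * S) * S ^ δ + A * B + p x ^ 2) * ((n : ℝ) ^ (-δ) / n) := by
    rw [abs_le] at hC hpsub hexp ⊢
    constructor <;> linarith [hC.1, hC.2, hpsub.1, hpsub.2, hexp.1, hexp.2]
  have hpow : Real.exp (-p x) = Real.exp (-(p x / n)) ^ n := by
    rw [← Real.exp_nat_mul]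
    congr 1
    field_simp
  have hexp01 : Real.exp (-(p x / n)) ∈ Set.Icc (0 : ℝ) 1 :=
    ⟨(Real.exp_pos _).le, Real.exp_le_one_iff.2 (neg_nonpos.2 (div_nonneg hpx hnpos.le))⟩
  calc |C w ^ n - Real.exp (-p x)| ≤ n * |C w - Real.exp (-(p x / n))| := by
        rw [hpow]
        exact abs_pow_sub_pow_le_mul_of_mem_Icc (hCrange w hw01) hexp01 n
    _ ≤ n * ((K * (A * S) * S ^ δ + A * B + p x ^ 2) * ((n : ℝ) ^ (-δ) / n)) := by gcongr
    _ = (K * (A * S) * S ^ δ + A * B + p x ^ 2) * (n : ℝ) ^ (-δ) := by field_simp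
    _ ≤ _ := mul_le_mul_of_nonneg_right (by linarith) (by positivity)
end
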